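/- Let D be a directed graph on n ≥ 2 vertices. Then D is strong and coverable if and only if there exists an integer q ≥ 2 and an expansive automata network f : [q]^n → [q]^n whose interaction graph is D. -/

import Mathlib

/-- Arc `u → v` of the interaction graph of the automata network `f`:
`f_v` depends essentially on coordinate `u`. -/
def hasArc {n : ℕ} {α : Type*} (f : (Fin n → α) → (Fin n → α)) (u v : Fin n) : Prop :=
  ∃ a b : Fin n → α, (∀ w : Fin n, w ≠ u → a w = b w) ∧ f a v ≠ f b v

/-- An automata network `f` is *expansive* if for all distinct configurations `x, y`
and every node `v` there exists `t ≥ 1` with `f^t(x)_v ≠ f^t(y)_v`. -/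
def Expansive {n : ℕ} {α : Type*} (f : (Fin n → α) → (Fin n → α)) : Prop :=
  ∀ x y : Fin n → α, x ≠ y → ∀ v : Fin n, ∃ t : ℕ, 1 ≤ t ∧ f^[t] x v ≠ f^[t] y v

section Necessity

variable {n : ℕ} {α : Type*}

theorem apply_eq_of_forall_hasArc {f : (Fin n → α) → (Fin n → α)} {v : Fin n}
    {x y : Fin n → α} (h : ∀ u, hasArc f u v → x u = y u) : f x v = f y v := by
  classical
  have key : ∀ S : Finset (Fin n), f (S.piecewise y x) v = f x v := by
    intro S
    induction S using Finset.induction_on with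
    | empty => simp
    | insert a S ha ih =>
      rw [← ih, Finset.piecewise_insert]
      by_cases harc : hasArc f a v
      · rw [← h a harc]
        congr 1
        rw [Function.update_eq_self_iff]
        simp [ha]
      · by_contra hne
        exact harc ⟨_, _, fun w hw => Function.update_of_ne hw _ _, hne⟩
  simpa using (key Finset.univ).symm

theorem reflTransGen_of_iterate_ne {f : (Fin n → α) → (Fin n → α)} {u : Fin n}
    {x y : Fin n → α} (hxy : ∀ w, w ≠ u → x w = y w) (t : ℕ) (v : Fin n)
    (h : f^[t] x v ≠ f^[t] y v) : Relation.ReflTransGen (hasArc f) u v := by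
  induction t generalizing v with
  | zero =>
    by_cases hv : v = u
    · exact hv ▸ Relation.ReflTransGen.refl
    · exact absurd (hxy v hv) h
  | succ t ih =>
    rw [Function.iterate_succ_apply', Function.iterate_succ_apply'] at h
    by_contra hno
    refine h (apply_eq_of_forall_hasArc fun w hw => ?_)
    by_contra hne
    exact hno ((ih w hne).tail hw)

theorem Expansive.reflTransGen [Nontrivial α] {f : (Fin n → α) → (Fin n → α)}
    (hf : Expansive f) (u v : Fin n) : Relation.ReflTransGen (hasArc f) u v := by
  obtain ⟨a, b, hab⟩ := exists_pair_ne α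
  obtain ⟨t, -, ht⟩ := hf (fun _ => a) (Function.update (fun _ => a) u b)
    (fun h => hab (by simpa using congrFun h u)) v
  exact reflTransGen_of_iterate_ne (fun w hw => by simp [hw]) t v ht

theorem Expansive.injective (hn : n ≠ 0) {f : (Fin n → α) → (Fin n → α)}
    (hf : Expansive f) : Function.Injective f := by
  intro x y hxy
  by_contra hne
  obtain ⟨t, ht, h⟩ := hf x y hne ⟨0, Nat.pos_of_ne_zero hn⟩
  obtain ⟨s, rfl⟩ := Nat.exists_eq_add_of_le' ht
  rw [Function.iterate_succ_apply, Function.iterate_succ_apply, hxy] at h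
  exact h rfl

theorem exists_perm_hasArc [Finite α] [Nontrivial α] {f : (Fin n → α) → (Fin n → α)}
    (hf : Function.Injective f) : ∃ π : Equiv.Perm (Fin n), ∀ v, hasArc f v (π v) := by
  classical
  have := Fintype.ofFinite α
  have hsurj : Function.Surjective f := Finite.surjective_of_injective hf
  obtain ⟨g, hg, hgarc⟩ := (Finset.all_card_le_biUnion_card_iff_exists_injective
    (fun v : Fin n => Finset.univ.filter fun u => hasArc f u v)).1 (by
      intro S
      set T := S.biUnion fun v : Fin n => Finset.univ.filter fun u => hasArc f u v with hT
      obtain ⟨a⟩ : Nonempty α := inferInstance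
      let F : (T → α) → (S → α) := fun g v => f (fun u => if h : u ∈ T then g ⟨u, h⟩ else a) v
      have hF : Function.Surjective F := by
        intro z
        obtain ⟨x, hx⟩ := hsurj (fun u => if h : u ∈ S then z ⟨u, h⟩ else a)
        refine ⟨fun u => x u, funext fun v => ?_⟩
        have h1 : f x v = z v := by rw [hx]; simp
        rw [← h1]
        refine apply_eq_of_forall_hasArc fun u hu => ?_
        have : u ∈ T := by
          rw [hT, Finset.mem_biUnion]
          exact ⟨v, v.2, by simpa using hu⟩
        simp [this]
      have hcard := Fintype.card_le_of_surjective F hF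
      simp only [Fintype.card_fun, Fintype.card_coe] at hcard
      exact (Nat.pow_le_pow_iff_right Fintype.one_lt_card).1 hcard)
  let σ : Equiv.Perm (Fin n) := Equiv.ofBijective g (Finite.injective_iff_bijective.1 hg)
  refine ⟨σ.symm, fun v => ?_⟩
  have h := hgarc (σ.symm v)
  rw [show g (σ.symm v) = v from σ.apply_symm_apply v] at h
  simpa using h

end Necessity

section ComplexWeights

open Matrix

variable {V : Type*} [Fintype V]

/-- On `U`, the number `μ` is not an eigenvalue of `A`, and nonzero solutions of
`(μ - A) w = c • e_r` do not vanish at `v`. -/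
def IsRegularValue (v : V) (U : Set V) (A : Matrix V V ℂ) (μ : ℂ) : Prop :=
  (∀ w : V → ℂ, (∀ t ∈ U, (A *ᵥ w) t = μ * w t) → ∀ t ∈ U, w t = 0) ∧
  ∀ r ∈ U, ∀ (c : ℂ) (w : V → ℂ),
    (∀ t ∈ U, t ≠ r → (A *ᵥ w) t = μ * w t) → (A *ᵥ w) r + c = μ * w r →
    w v = 0 → ∀ t ∈ U, w t = 0

/-- The matrix `A`, whose support is contained in `U × U` and in the transpose of `D`, has no
eigenvector on `U` vanishing at `v`, is injective on `U`, and all but finitely many values are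
regular for it. -/
structure IsObservableOn (D : V → V → Prop) (v : V) (U : Set V) (A : Matrix V V ℂ) : Prop where
  support : ∀ t u, A t u ≠ 0 → t ∈ U ∧ u ∈ U ∧ D u t
  eigen : ∀ (μ : ℂ) (w : V → ℂ), (∀ t ∈ U, (A *ᵥ w) t = μ * w t) → w v = 0 → ∀ t ∈ U, w t = 0
  ker : ∀ w : V → ℂ, (∀ t ∈ U, (A *ᵥ w) t = 0) → ∀ t ∈ U, w t = 0
  regular : {μ | ¬ IsRegularValue v U A μ}.Finite

theorem IsObservableOn.mulVec_apply_eq_zero {D : V → V → Prop} {v : V} {U : Set V}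
    {A : Matrix V V ℂ} (hA : IsObservableOn D v U A) (w : V → ℂ) {t : V} (ht : t ∉ U) :
    (A *ᵥ w) t = 0 :=
  Finset.sum_eq_zero fun u _ => by
    have : A t u = 0 := by
      by_contra h
      exact ht (hA.support t u h).1
    simp [this]

theorem IsObservableOn.mulVec_apply_eq_zero_of_forall_mem {D : V → V → Prop} {v : V} {U : Set V}
    {A : Matrix V V ℂ} (hA : IsObservableOn D v U A) {w : V → ℂ} (hw : ∀ t ∈ U, w t = 0) (t : V) :
    (A *ᵥ w) t = 0 :=
  Finset.sum_eq_zero fun u _ => by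
    by_cases h : A t u = 0
    · simp [h]
    · simp [hw u (hA.support t u h).2.1]

theorem Equiv.Perm.SameCycle.induction_forward {π : Equiv.Perm V} {u a : V}
    (ha : π.SameCycle u a) {P : V → Prop} (h0 : P a)
    (hs : ∀ t, π.SameCycle u t → P t → P (π t)) {t : V} (ht : π.SameCycle u t) : P t := by
  obtain ⟨j, rfl⟩ := (ha.symm.trans ht).exists_nat_pow_eq
  clear ht
  induction j with
  | zero => simpa using h0
  | succ j ih =>
    rw [pow_succ', Equiv.Perm.mul_apply]
    exact hs _ (Equiv.Perm.sameCycle_pow_right.2 ha) ih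

theorem Equiv.Perm.SameCycle.induction_backward {π : Equiv.Perm V} {u a : V}
    (ha : π.SameCycle u a) {P : V → Prop} (h0 : P a)
    (hs : ∀ t, π.SameCycle u t → P (π t) → P t) {t : V} (ht : π.SameCycle u t) : P t := by
  by_contra hP
  exact Equiv.Perm.SameCycle.induction_forward ht (P := fun t => ¬ P t) hP
    (fun t ht h h' => h (hs t ht h')) ha h0

variable [DecidableEq V]

open Classical in
/-- The weighted permutation matrix of the cycle of `π` through `u`, with all weights `lam`. -/
noncomputable def cycleMatrix (π : Equiv.Perm V) (u : V) (lam : ℂ) : Matrix V V ℂ :=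
  Matrix.of fun t r => if π.SameCycle u t ∧ π r = t then lam else 0

theorem cycleMatrix_mulVec {π : Equiv.Perm V} {u : V} {lam : ℂ} (w : V → ℂ) {r : V}
    (hr : π.SameCycle u r) : (cycleMatrix π u lam *ᵥ w) (π r) = lam * w r := by
  have : π.SameCycle u (π r) := Equiv.Perm.sameCycle_apply_right.2 hr
  simp [cycleMatrix, Matrix.mulVec, dotProduct, this]

theorem pow_eq_of_cycleMatrix_eigen {π : Equiv.Perm V} {u : V} {lam μ : ℂ} {w : V → ℂ}
    (h : ∀ t, π.SameCycle u t → (cycleMatrix π u lam *ᵥ w) t = μ * w t) {t : V}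
    (ht : π.SameCycle u t) (hw : w t ≠ 0) : μ ^ orderOf π = lam ^ orderOf π := by
  have key : ∀ k : ℕ, μ ^ k * w ((π ^ k) t) = lam ^ k * w t := by
    intro k
    induction k with
    | zero => simp
    | succ k ih =>
      have hk : π.SameCycle u ((π ^ k) t) := Equiv.Perm.sameCycle_pow_right.2 ht
      have h1 := h _ (Equiv.Perm.sameCycle_apply_right.2 hk)
      rw [cycleMatrix_mulVec w hk] at h1
      rw [pow_succ' π, Equiv.Perm.mul_apply, pow_succ μ, mul_assoc, ← h1, pow_succ lam]
      linear_combination lam * ih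
  have := key (orderOf π)
  rw [pow_orderOf_eq_one] at this
  exact mul_right_cancel₀ hw (by simpa using this)

theorem isObservableOn_cycleMatrix {D : V → V → Prop} {π : Equiv.Perm V}
    (hπ : ∀ v, D v (π v)) (u : V) {lam : ℂ} (hlam : lam ≠ 0) :
    IsObservableOn D u {t | π.SameCycle u t} (cycleMatrix π u lam) := by
  have eigen : ∀ a, π.SameCycle u a → ∀ (μ : ℂ) (w : V → ℂ),
      (∀ t, π.SameCycle u t → (cycleMatrix π u lam *ᵥ w) t = μ * w t) → w a = 0 →
      ∀ t, π.SameCycle u t → w t = 0 := by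
    intro a ha μ w h hw t ht
    refine Equiv.Perm.SameCycle.induction_backward ha (P := fun t => w t = 0) hw
      (fun t ht h0 => ?_) ht
    have h1 := h _ (Equiv.Perm.sameCycle_apply_right.2 ht)
    rw [cycleMatrix_mulVec w ht, h0, mul_zero] at h1
    exact (mul_eq_zero.1 h1).resolve_left hlam
  refine ⟨?_, eigen u (Equiv.Perm.SameCycle.refl _ _), ?_, ?_⟩
  · intro t r h
    simp only [cycleMatrix, Matrix.of_apply, ne_eq, ite_eq_right_iff, Classical.not_imp] at h
    obtain ⟨⟨ht, rfl⟩, -⟩ := h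
    exact ⟨ht, Equiv.Perm.sameCycle_apply_right.1 ht, hπ r⟩
  · intro w h t ht
    have h1 := h _ (Equiv.Perm.sameCycle_apply_right.2 ht)
    rw [cycleMatrix_mulVec w ht] at h1
    exact (mul_eq_zero.1 h1).resolve_left hlam
  · refine ((Polynomial.nthRoots (orderOf π) (lam ^ orderOf π)).toFinset.finite_toSet.insert 0).subset
      fun μ hμ' => ?_
    by_contra hμ
    refine hμ' ?_
    simp only [Set.mem_insert_iff, Finset.mem_coe, Multiset.mem_toFinset,
      Polynomial.mem_nthRoots (orderOf_pos π), not_or] at hμ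
    obtain ⟨hμ0, hμ⟩ := hμ
    refine ⟨fun w h t ht => ?_, fun r hr c w h hr' hu => ?_⟩
    · by_contra hw
      exact hμ (pow_eq_of_cycleMatrix_eigen h ht hw)
    · have hstep : ∀ t, π.SameCycle u t → π t ≠ r → lam * w t = μ * w (π t) := by
        intro t ht hne
        rw [← cycleMatrix_mulVec w ht]
        exact h _ (Equiv.Perm.sameCycle_apply_right.2 ht) hne
      have hpre : π.SameCycle u (π.symm r) := by
        rw [← Equiv.Perm.sameCycle_apply_right, Equiv.apply_symm_apply]
        exact hr
      have hwpre : w (π.symm r) = 0 := by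
        by_contra hne
        refine Equiv.Perm.SameCycle.induction_backward hpre (P := fun t => w t ≠ 0) hne
          (fun t ht h0 => ?_) (Equiv.Perm.SameCycle.refl _ _) hu
        by_cases htr : π t = r
        · rwa [← htr, Equiv.symm_apply_apply] at hne
        · intro h1
          have := hstep t ht htr
          rw [h1, mul_zero] at this
          exact mul_ne_zero hμ0 h0 this.symm
      have hwr : w r = 0 := by
        by_contra hne
        refine Equiv.Perm.SameCycle.induction_forward hr (P := fun t => w t ≠ 0) hne
          (fun t ht h0 => ?_) hpre hwpre
        by_cases htr : π t = r
        · rwa [htr]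
        · intro h1
          have := hstep t ht htr
          rw [h1, mul_zero] at this
          exact mul_ne_zero hlam h0 this
      refine eigen u (Equiv.Perm.SameCycle.refl _ _) μ w (fun t ht => ?_) hu
      by_cases htr : t = r
      · have h1 := cycleMatrix_mulVec (lam := lam) w hpre
        rw [Equiv.apply_symm_apply, hwpre, mul_zero] at h1
        rw [htr, h1, hwr, mul_zero]
      · exact h t ht htr

theorem IsObservableOn.union {D : V → V → Prop} {v u s : V} {U C : Set V} {A B : Matrix V V ℂ}
    (hA : IsObservableOn D v U A) (hB : IsObservableOn D u C B) (hdisj : ∀ t ∈ C, t ∉ U)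
    (hs : s ∈ U) (hu : u ∈ C) (hus : D u s)
    (hspec : ∀ μ w, (∀ t ∈ C, (B *ᵥ w) t = μ * w t) → (∃ t ∈ C, w t ≠ 0) →
      IsRegularValue v U A μ) :
    IsObservableOn D v (U ∪ C) (A + B + Matrix.single s u 1) := by
  have rowC : ∀ (w : V → ℂ), ∀ t ∈ C, ((A + B + Matrix.single s u 1) *ᵥ w) t = (B *ᵥ w) t := by
    intro w t ht
    have hts : t ≠ s := fun h => hdisj t ht (h ▸ hs)
    simp [Matrix.add_mulVec, Matrix.single_mulVec, hts,
      hA.mulVec_apply_eq_zero w (hdisj t ht)]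
  have rowU : ∀ (w : V → ℂ), ∀ t ∈ U, t ≠ s →
      ((A + B + Matrix.single s u 1) *ᵥ w) t = (A *ᵥ w) t := by
    intro w t ht hts
    simp [Matrix.add_mulVec, Matrix.single_mulVec, hts,
      hB.mulVec_apply_eq_zero w (fun h => hdisj t h ht)]
  have rows : ∀ w : V → ℂ,
      ((A + B + Matrix.single s u 1) *ᵥ w) s = (A *ᵥ w) s + w u := by
    intro w
    simp [Matrix.add_mulVec, Matrix.single_mulVec,
      hB.mulVec_apply_eq_zero w (fun h => hdisj s h hs)]
  have rowU' : ∀ w : V → ℂ, w u = 0 → ∀ t ∈ U,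
      ((A + B + Matrix.single s u 1) *ᵥ w) t = (A *ᵥ w) t := by
    intro w hw t ht
    by_cases hts : t = s
    · rw [hts, rows, hw, add_zero]
    · exact rowU w t ht hts
  have source_eq_zero : ∀ (μ : ℂ) (w : V → ℂ), (∀ t ∈ U, w t = 0) → (A *ᵥ w) s + w u = μ * w s →
      w u = 0 := by
    intro μ w h0 h
    simpa [hA.mulVec_apply_eq_zero_of_forall_mem h0 s, h0 s hs] using h
  refine ⟨?_, ?_, ?_, ?_⟩
  · intro t r h
    by_cases hAt : A t r = 0
    · by_cases hBt : B t r = 0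
      · simp only [Matrix.add_apply, hAt, hBt, Matrix.single_apply, zero_add, ne_eq, ite_eq_right_iff,
          one_ne_zero, imp_false, not_not] at h
        rw [← h.1, ← h.2]
        exact ⟨Or.inl hs, Or.inr hu, hus⟩
      · obtain ⟨h1, h2, h3⟩ := hB.support _ _ hBt
        exact ⟨Or.inr h1, Or.inr h2, h3⟩
    · obtain ⟨h1, h2, h3⟩ := hA.support _ _ hAt
      exact ⟨Or.inl h1, Or.inl h2, h3⟩
  · intro μ w h hw
    have hC : ∀ t ∈ C, (B *ᵥ w) t = μ * w t := fun t ht => by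
      rw [← rowC w t ht]
      exact h t (Or.inr ht)
    have hwC : ∀ t ∈ C, w t = 0 := by
      by_contra! hne
      have hs' : (A *ᵥ w) s + w u = μ * w s := by rw [← rows]; exact h s (Or.inl hs)
      have h0 := (hspec μ w hC hne).2 s hs (w u) w
        (fun t ht hts => by rw [← rowU w t ht hts]; exact h t (Or.inl ht)) hs' hw
      obtain ⟨t, ht, hwt⟩ := hne
      exact hwt (hB.eigen μ w hC (source_eq_zero μ w h0 hs') t ht)
    have hwU := hA.eigen μ w (fun t ht => by
      rw [← rowU' w (hwC u hu) t ht]; exact h t (Or.inl ht)) hw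
    rintro t (ht | ht)
    exacts [hwU t ht, hwC t ht]
  · intro w h
    have hwC := hB.ker w (fun t ht => by rw [← rowC w t ht]; exact h t (Or.inr ht))
    have hwU := hA.ker w (fun t ht => by
      rw [← rowU' w (hwC u hu) t ht]; exact h t (Or.inl ht))
    rintro t (ht | ht)
    exacts [hwU t ht, hwC t ht]
  · refine (hA.regular.union hB.regular).subset fun μ hμ' => ?_
    by_contra hμ
    simp only [Set.mem_union, Set.mem_ofPred_eq, not_or, not_not] at hμ
    obtain ⟨hμA, hμB⟩ := hμ
    refine hμ' ⟨fun w h => ?_, fun r hr c w h hrow hw => ?_⟩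
    · have hwC := hμB.1 w (fun t ht => by rw [← rowC w t ht]; exact h t (Or.inr ht))
      have hwU := hμA.1 w (fun t ht => by
        rw [← rowU' w (hwC u hu) t ht]; exact h t (Or.inl ht))
      rintro t (ht | ht)
      exacts [hwU t ht, hwC t ht]
    · rcases hr with hr | hr
      · have hwC := hμB.1 w (fun t ht => by
          rw [← rowC w t ht]
          exact h t (Or.inr ht) (fun htr => hdisj t ht (htr ▸ hr)))
        have hwU := hμA.2 r hr c w
          (fun t ht htr => by rw [← rowU' w (hwC u hu) t ht]; exact h t (Or.inl ht) htr)
          (by rw [← rowU' w (hwC u hu) r hr]; exact hrow) hw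
        rintro t (ht | ht)
        exacts [hwU t ht, hwC t ht]
      · have hne : ∀ t ∈ U, t ≠ r := fun t ht htr => hdisj r hr (htr ▸ ht)
        have hs' : (A *ᵥ w) s + w u = μ * w s := by
          rw [← rows]
          exact h s (Or.inl hs) (hne s hs)
        have hwU := hμA.2 s hs (w u) w (fun t ht hts => by
          rw [← rowU w t ht hts]; exact h t (Or.inl ht) (hne t ht)) hs' hw
        have hwC := hμB.2 r hr c w
          (fun t ht htr => by rw [← rowC w t ht]; exact h t (Or.inr ht) htr)
          (by rw [← rowC w r hr]; exact hrow) (source_eq_zero μ w hwU hs')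
        rintro t (ht | ht)
        exacts [hwU t ht, hwC t ht]

theorem exists_isObservableOn_univ {D : V → V → Prop}
    (hD : ∀ u v, Relation.ReflTransGen D u v) {π : Equiv.Perm V} (hπ : ∀ v, D v (π v)) (v : V) :
    ∃ A, IsObservableOn D v Set.univ A := by
  obtain ⟨U, hU⟩ := Set.Finite.exists_maximal
    (s := {U : Set V | v ∈ U ∧ (∀ t ∈ U, ∀ r, π.SameCycle t r → r ∈ U) ∧
      ∃ A, IsObservableOn D v U A}) (Set.toFinite _)
    ⟨{t | π.SameCycle v t}, Equiv.Perm.SameCycle.refl _ _, fun t ht r hr => ht.trans hr,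
      _, isObservableOn_cycleMatrix hπ v one_ne_zero⟩
  obtain ⟨⟨hv, hinv, A, hA⟩, hmax⟩ := hU
  by_cases huniv : U = Set.univ
  · exact ⟨A, huniv ▸ hA⟩
  exfalso
  obtain ⟨a, ha⟩ := (Set.ne_univ_iff_exists_notMem U).1 huniv
  obtain ⟨u, s, hus, hu, hs⟩ : ∃ u s, D u s ∧ u ∉ U ∧ s ∈ U := by
    by_contra! hno
    have : ∀ b, Relation.ReflTransGen D a b → b ∉ U := by
      intro b hb
      induction hb with
      | refl => exact ha
      | tail _ h ih => exact hno _ _ h ih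
    exact this v (hD a v) hv
  have hpos := orderOf_pos π
  obtain ⟨-, ⟨k, rfl⟩, hk⟩ := (Set.infinite_range_of_injective
    (f := fun k : ℕ => ((k + 1 : ℕ) : ℂ) ^ orderOf π) (fun i j hij => by
      simp only [← Nat.cast_pow, Nat.cast_inj] at hij
      simpa using Nat.pow_left_injective hpos.ne' hij)).exists_notMem_finite
    (hA.regular.image fun μ => μ ^ orderOf π)
  have hlam : ((k + 1 : ℕ) : ℂ) ≠ 0 := Nat.cast_ne_zero.2 k.succ_ne_zero
  have hdisj : ∀ t ∈ {t | π.SameCycle u t}, t ∉ U := fun t ht htU => hu (hinv t htU u ht.symm)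
  have hnew := hA.union (isObservableOn_cycleMatrix hπ u hlam) hdisj hs
    (Equiv.Perm.SameCycle.refl _ _) hus (by
      rintro μ w hw ⟨t, ht, hwt⟩
      by_contra hreg
      exact hk ⟨μ, hreg, pow_eq_of_cycleMatrix_eigen hw ht hwt⟩)
  refine hu (hmax ⟨Or.inl hv, ?_, _, hnew⟩ Set.subset_union_left
    (Or.inr (Equiv.Perm.SameCycle.refl _ _)))
  rintro t (ht | ht) r hr
  exacts [Or.inl (hinv t ht r hr), Or.inr (ht.trans hr)]

end ComplexWeights

section Krylov

open Matrix

variable {n : ℕ}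

/-- The matrix whose rows are the rows of index `v` of `1, A, …, A ^ (n - 1)`. -/
def krylovMatrix {R : Type*} [CommRing R] (A : Matrix (Fin n) (Fin n) R) (v : Fin n) :
    Matrix (Fin n) (Fin n) R :=
  Matrix.of fun t : Fin n => (A ^ (t : ℕ)) v

theorem krylovMatrix_mulVec {R : Type*} [CommRing R] (A : Matrix (Fin n) (Fin n) R) (v : Fin n)
    (x : Fin n → R) (t : Fin n) : (krylovMatrix A v *ᵥ x) t = (A ^ (t : ℕ) *ᵥ x) v :=
  rfl

theorem map_krylovMatrix {R S : Type*} [CommRing R] [CommRing S] (φ : R →+* S)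
    (A : Matrix (Fin n) (Fin n) R) (v : Fin n) :
    φ.mapMatrix (krylovMatrix A v) = krylovMatrix (φ.mapMatrix A) v := by
  ext t u
  exact congrFun (congrFun (map_pow φ.mapMatrix A t) v) u

theorem det_krylovMatrix_ne_zero {A : Matrix (Fin n) (Fin n) ℂ} {v : Fin n}
    (h : ∀ (μ : ℂ) (w : Fin n → ℂ), A *ᵥ w = μ • w → w v = 0 → w = 0) :
    (krylovMatrix A v).det ≠ 0 := by
  intro hdet
  obtain ⟨x, hx, hkx⟩ := Matrix.exists_mulVec_eq_zero_iff.2 hdet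
  have hn : n ≠ 0 := fun h0 => (h0 ▸ v).elim0
  have hall : ∀ t : ℕ, (A ^ t *ᵥ x) v = 0 := by
    intro t
    have hdeg : (Polynomial.X ^ t %ₘ A.charpoly).natDegree < n := by
      have hlt := Polynomial.natDegree_modByMonic_lt (Polynomial.X ^ t) A.charpoly_monic
        (fun h1 => hn (by simpa [h1] using (A.charpoly_natDegree_eq_dim).symm))
      simpa using hlt
    rw [Matrix.pow_eq_aeval_mod_charpoly, Polynomial.aeval_eq_sum_range' hdeg, Matrix.sum_mulVec,
      Finset.sum_apply]
    refine Finset.sum_eq_zero fun i hi => ?_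
    have := congrFun hkx ⟨i, Finset.mem_range.1 hi⟩
    rw [krylovMatrix_mulVec] at this
    simp only [Pi.zero_apply] at this
    rw [Matrix.smul_mulVec, Pi.smul_apply, this, smul_zero]
  let W : Submodule ℂ (Fin n → ℂ) :=
    { carrier := {y | ∀ t : ℕ, (A ^ t *ᵥ y) v = 0}
      add_mem' := fun {y z} hy hz t => by rw [Matrix.mulVec_add, Pi.add_apply, hy t, hz t, add_zero]
      zero_mem' := fun t => by rw [Matrix.mulVec_zero, Pi.zero_apply]
      smul_mem' := fun c y hy t => by rw [Matrix.mulVec_smul, Pi.smul_apply, hy t, smul_zero] }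
  have hW : ∀ y ∈ W, A.mulVecLin y ∈ W := fun y hy t => by
    rw [Matrix.mulVecLin_apply, Matrix.mulVec_mulVec, ← pow_succ]
    exact hy (t + 1)
  have : Nontrivial W := ⟨⟨⟨x, hall⟩, 0, fun h => hx (congrArg Subtype.val h)⟩⟩
  obtain ⟨μ, hμ⟩ := Module.End.exists_eigenvalue (A.mulVecLin.restrict hW)
  obtain ⟨w, hw⟩ := hμ.exists_hasEigenvector
  refine hw.2 (Subtype.ext (h μ w (congrArg Subtype.val hw.apply_eq_smul) ?_))
  simpa using w.2 0

theorem expansive_mulVec {K : Type*} [Field K] {A : Matrix (Fin n) (Fin n) K} (hA : A.det ≠ 0)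
    (hk : ∀ v, (krylovMatrix A v).det ≠ 0) : Expansive (fun x => A *ᵥ x) := by
  intro x y hxy v
  have hiter : ∀ (t : ℕ) (z : Fin n → K), (fun x => A *ᵥ x)^[t] z = A ^ t *ᵥ z := by
    intro t z
    induction t with
    | zero => simp
    | succ t ih => rw [Function.iterate_succ_apply', ih, Matrix.mulVec_mulVec, ← pow_succ']
  by_contra! h
  refine hxy (sub_eq_zero.1 (Matrix.eq_zero_of_mulVec_eq_zero hA
    (Matrix.eq_zero_of_mulVec_eq_zero (hk v) (funext fun t => ?_))))
  have := h (t + 1) (Nat.le_add_left _ _)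
  rw [hiter, hiter] at this
  rw [krylovMatrix_mulVec, Matrix.mulVec_mulVec, ← pow_succ, Matrix.mulVec_sub, Pi.sub_apply, this,
    sub_self, Pi.zero_apply]

theorem hasArc_mulVec_iff {K : Type*} [CommRing K] (A : Matrix (Fin n) (Fin n) K) (u v : Fin n) :
    hasArc (fun x => A *ᵥ x) u v ↔ A v u ≠ 0 := by
  constructor
  · rintro ⟨a, b, hab, hne⟩ h0
    refine hne ?_
    simp only [Matrix.mulVec, dotProduct]
    refine Finset.sum_congr rfl fun w _ => ?_
    by_cases hw : w = u
    · rw [hw, h0, zero_mul, zero_mul]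
    · rw [hab w hw]
  · intro h
    exact ⟨Pi.single u 1, 0, fun w hw => by simp [hw], by simpa using h⟩

open Classical in
/-- The matrix whose entries at the arcs of `D` are distinct indeterminates. -/
noncomputable def genericMatrix (D : Fin n → Fin n → Prop) :
    Matrix (Fin n) (Fin n) (MvPolynomial (Fin n × Fin n) ℤ) :=
  Matrix.of fun v u => if D u v then MvPolynomial.X (u, v) else 0

theorem det_genericMatrix_ne_zero {D : Fin n → Fin n → Prop}
    (hD : ∀ u v, Relation.ReflTransGen D u v) {π : Equiv.Perm (Fin n)} (hπ : ∀ v, D v (π v))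
    (v : Fin n) :
    (genericMatrix D).det ≠ 0 ∧ (krylovMatrix (genericMatrix D) v).det ≠ 0 := by
  obtain ⟨A, hA⟩ := exists_isObservableOn_univ hD hπ v
  let φ : MvPolynomial (Fin n × Fin n) ℤ →+* ℂ :=
    MvPolynomial.eval₂Hom (Int.castRingHom ℂ) fun e => A e.2 e.1
  have hφ : φ.mapMatrix (genericMatrix D) = A := by
    ext s u
    by_cases h : D u s
    · simp [genericMatrix, φ, h]
    · have : A s u = 0 := by
        by_contra h0
        exact h (hA.support s u h0).2.2
      simp [genericMatrix, h, this]
  constructor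
  · intro h
    have h1 : A.det = 0 := by rw [← hφ, ← RingHom.map_det, h, map_zero]
    obtain ⟨x, hx, hAx⟩ := Matrix.exists_mulVec_eq_zero_iff.2 h1
    exact hx (funext fun t => hA.ker x (fun t _ => congrFun hAx t) t trivial)
  · intro h
    refine det_krylovMatrix_ne_zero (A := A) (v := v) (fun μ w hw hv => funext fun t =>
      hA.eigen μ w (fun t _ => congrFun hw t) hv t trivial) ?_
    rw [← hφ, ← map_krylovMatrix, ← RingHom.map_det, h, map_zero]

theorem exists_prime_expansive {D : Fin n → Fin n → Prop} (hn : n ≠ 0)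
    (hD : ∀ u v, Relation.ReflTransGen D u v) {π : Equiv.Perm (Fin n)} (hπ : ∀ v, D v (π v)) :
    ∃ p : ℕ, p.Prime ∧ ∃ f : (Fin n → ZMod p) → (Fin n → ZMod p),
      (∀ u v, hasArc f u v ↔ D u v) ∧ Expansive f := by
  let P : MvPolynomial (Fin n × Fin n) ℤ :=
    (genericMatrix D).det * (∏ v, (krylovMatrix (genericMatrix D) v).det) *
      ∏ e, MvPolynomial.X e
  have hP : P ≠ 0 := mul_ne_zero (mul_ne_zero
    (det_genericMatrix_ne_zero hD hπ ⟨0, Nat.pos_of_ne_zero hn⟩).1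
    (Finset.prod_ne_zero_iff.2 fun v _ => (det_genericMatrix_ne_zero hD hπ v).2))
    (Finset.prod_ne_zero_iff.2 fun e _ => MvPolynomial.X_ne_zero e)
  obtain ⟨a, ha⟩ : ∃ a : Fin n × Fin n → ℤ, MvPolynomial.eval a P ≠ 0 := by
    by_contra! h
    exact hP (MvPolynomial.funext fun a => by rw [h a, map_zero])
  obtain ⟨p, hle, hp⟩ := Nat.exists_infinite_primes ((MvPolynomial.eval a P).natAbs + 1)
  have : Fact p.Prime := ⟨hp⟩
  let φ : MvPolynomial (Fin n × Fin n) ℤ →+* ZMod p :=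
    (Int.castRingHom (ZMod p)).comp (MvPolynomial.eval a)
  have hφ : φ P ≠ 0 := by
    intro h
    have h1 : ((MvPolynomial.eval a P : ℤ) : ZMod p) = 0 := h
    rw [ZMod.intCast_zmod_eq_zero_iff_dvd] at h1
    have h2 := Nat.le_of_dvd (Int.natAbs_pos.2 ha) (Int.natCast_dvd.1 h1)
    omega
  simp only [P, map_mul, map_prod, mul_ne_zero_iff, Finset.prod_ne_zero_iff, RingHom.map_det,
    map_krylovMatrix] at hφ
  obtain ⟨⟨h1, h2⟩, h3⟩ := hφ
  refine ⟨p, hp, fun x => φ.mapMatrix (genericMatrix D) *ᵥ x, fun u v => ?_,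
    expansive_mulVec h1 fun v => h2 v (Finset.mem_univ _)⟩
  rw [hasArc_mulVec_iff]
  by_cases h : D u v
  · simpa [genericMatrix, h] using h3 (u, v) (Finset.mem_univ _)
  · simp [genericMatrix, h]

end Krylov

/-- Theorem: a directed graph `D` on `n ≥ 2` vertices is strong (a directed path between
any ordered pair of vertices) and coverable (a permutation `π` with an arc `v → π v`
for every `v`) if and only if there exists an alphabet size `q ≥ 2` and an expansive
automata network `f : [q]^n → [q]^n` whose interaction graph is exactly `D`. -/
theorem stmt_5 (n : ℕ) (hn : 2 ≤ n) (D : Fin n → Fin n → Prop) :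
    ((∀ u v : Fin n, Relation.ReflTransGen D u v) ∧
      (∃ π : Equiv.Perm (Fin n), ∀ v : Fin n, D v (π v)))
    ↔
    (∃ q : ℕ, 2 ≤ q ∧ ∃ f : (Fin n → Fin q) → (Fin n → Fin q),
      (∀ u v : Fin n, hasArc f u v ↔ D u v) ∧ Expansive f) := by
  constructor
  · rintro ⟨hD, π, hπ⟩
    obtain ⟨p, hp, f, hf⟩ := exists_prime_expansive (by omega) hD hπ
    cases p with
    | zero => exact absurd hp Nat.not_prime_zero
    | succ k => exact ⟨k + 1, hp.two_le, f, hf⟩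
  · rintro ⟨q, hq, f, hfD, hf⟩
    have : Nontrivial (Fin q) := Fin.nontrivial_iff_two_le.2 hq
    have hD : hasArc f = D := funext fun u => funext fun v => propext (hfD u v)
    subst hD
    exact ⟨hf.reflTransGen, exists_perm_hasArc (hf.injective (by omega))⟩
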